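/- Let P ∈ 𝔓_+ and c ∈ ℭ_+, and suppose that ∫_{𝕋^d} (1/Q) dm = ∞ for every Q ∈ ∂𝔓_+. Then the optimal solution Q̂ of the problem of minimizing J_P over 𝔓̄_+ \ {0} belongs to the open cone 𝔓_+. -/

import Mathlib

open MeasureTheory Complex Set

noncomputable section

namespace RCE

/-- The scalar product (k,θ) = Σⱼ kⱼ θⱼ. -/
def dotP (d : ℕ) (k : Fin d → ℤ) (θ : Fin d → ℝ) : ℝ := ∑ j, (k j : ℝ) * θ j

/-- The d-dimensional torus 𝕋^d = (−π,π]^d. -/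
def Td (d : ℕ) : Set (Fin d → ℝ) := Set.univ.pi fun _ => Set.Ioc (-Real.pi) Real.pi

/-- Normalized Lebesgue measure dm = (2π)^{-d} dθ on 𝕋^d. -/
def dm (d : ℕ) : Measure (Fin d → ℝ) :=
  (ENNReal.ofReal ((2 * Real.pi) ^ d))⁻¹ • (volume.restrict (Td d))

/-- Conjugate-symmetric coefficient sequences supported on Λ. -/
def IsCoeff (d : ℕ) (Λ : Finset (Fin d → ℤ)) (p : (Fin d → ℤ) → ℂ) : Prop :=
  (∀ k, k ∉ Λ → p k = 0) ∧ ∀ k, p (-k) = starRingEnd ℂ (p k)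

/-- Evaluation of the (real-valued) trigonometric polynomial
`P(e^{iθ}) = Σ_{k∈Λ} p_k e^{-i(k,θ)}`. -/
def eval (d : ℕ) (Λ : Finset (Fin d → ℤ)) (p : (Fin d → ℤ) → ℂ) (θ : Fin d → ℝ) : ℝ :=
  (∑ k ∈ Λ, p k * Complex.exp (-(dotP d k θ : ℂ) * Complex.I)).re

/-- `𝔓̄₊` : the closed cone of nonnegative trigonometric polynomials. -/
def Pbar (d : ℕ) (Λ : Finset (Fin d → ℤ)) : Set ((Fin d → ℤ) → ℂ) :=
  {p | IsCoeff d Λ p ∧ ∀ θ ∈ Td d, 0 ≤ eval d Λ p θ}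

/-- `𝔓₊` : the open cone of positive trigonometric polynomials. -/
def Pplus (d : ℕ) (Λ : Finset (Fin d → ℤ)) : Set ((Fin d → ℤ) → ℂ) :=
  {p | IsCoeff d Λ p ∧ ∀ θ ∈ Td d, 0 < eval d Λ p θ}

/-- The pairing ⟨c,p⟩ = Σ_{k∈Λ} c_k conj(p_k) (real-valued by conjugate symmetry). -/
def pair (d : ℕ) (Λ : Finset (Fin d → ℤ)) (c p : (Fin d → ℤ) → ℂ) : ℝ :=
  (∑ k ∈ Λ, c k * starRingEnd ℂ (p k)).re

/-- `ℭ₊` : the interior of the dual cone. -/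
def Cplus (d : ℕ) (Λ : Finset (Fin d → ℤ)) : Set ((Fin d → ℤ) → ℂ) :=
  {c | IsCoeff d Λ c ∧ ∀ p ∈ Pbar d Λ, p ≠ 0 → 0 < pair d Λ c p}

/-- `ℭ̄₊` : the closed dual cone. -/
def Cbar (d : ℕ) (Λ : Finset (Fin d → ℤ)) : Set ((Fin d → ℤ) → ℂ) :=
  {c | IsCoeff d Λ c ∧ ∀ p ∈ Pbar d Λ, 0 ≤ pair d Λ c p}

/-- The dual functional J_P(Q) = ⟨c,q⟩ − ∫ P log Q dm. -/
def J (d : ℕ) (Λ : Finset (Fin d → ℤ)) (c P Q : (Fin d → ℤ) → ℂ) : ℝ :=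
  pair d Λ c Q - ∫ θ, eval d Λ P θ * Real.log (eval d Λ Q θ) ∂(dm d)

/-- Covariance matching for an absolutely continuous measure Φ dm:
`c_k = ∫ e^{i(k,θ)} Φ(θ) dm(θ)` for all k ∈ Λ. -/
def Matches (d : ℕ) (Λ : Finset (Fin d → ℤ)) (c : (Fin d → ℤ) → ℂ)
    (Φ : (Fin d → ℝ) → ℝ) : Prop :=
  ∀ k ∈ Λ, c k = ∫ θ, Complex.exp ((dotP d k θ : ℂ) * Complex.I) * (Φ θ : ℂ) ∂(dm d)

/-- The complex exponential sum whose real part is `eval`. -/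
def csum (d : ℕ) (Λ : Finset (Fin d → ℤ)) (p : (Fin d → ℤ) → ℂ) (θ : Fin d → ℝ) : ℂ :=
  ∑ k ∈ Λ, p k * Complex.exp (-(dotP d k θ : ℂ) * Complex.I)

lemma dotP_neg (d : ℕ) (k : Fin d → ℤ) (θ : Fin d → ℝ) : dotP d (-k) θ = -dotP d k θ := by
  simp [dotP]

lemma dotP_add_smul (d : ℕ) (k : Fin d → ℤ) (y v : Fin d → ℝ) (t : ℝ) :
    dotP d k (y + t • v) = dotP d k y + t * dotP d k v := by
  simp only [dotP, Pi.add_apply, Pi.smul_apply, smul_eq_mul, Finset.mul_sum,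
    ← Finset.sum_add_distrib]
  exact Finset.sum_congr rfl fun j _ => by ring

lemma conj_csum {d : ℕ} {Λ : Finset (Fin d → ℤ)} (hΛ : ∀ k ∈ Λ, -k ∈ Λ)
    {p : (Fin d → ℤ) → ℂ} (hp : IsCoeff d Λ p) (θ : Fin d → ℝ) :
    starRingEnd ℂ (csum d Λ p θ) = csum d Λ p θ := by
  rw [csum, map_sum]
  refine Finset.sum_nbij' (fun k => -k) (fun k => -k) hΛ hΛ (by simp) (by simp) fun k _ => ?_
  rw [map_mul, ← Complex.exp_conj, hp.2, dotP_neg]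
  simp

lemma csum_eq_eval {d : ℕ} {Λ : Finset (Fin d → ℤ)} (hΛ : ∀ k ∈ Λ, -k ∈ Λ)
    {p : (Fin d → ℤ) → ℂ} (hp : IsCoeff d Λ p) (θ : Fin d → ℝ) :
    csum d Λ p θ = (eval d Λ p θ : ℂ) :=
  (Complex.conj_eq_iff_re.1 (conj_csum hΛ hp θ)).symm

/-- A direction along which distinct integer frequencies stay distinct. -/
lemma exists_dotP_injective (d : ℕ) :
    ∃ v : Fin d → ℝ, Function.Injective fun k : Fin d → ℤ => dotP d k v := by
  obtain ⟨s, hs⟩ : ∃ s : ℝ, Transcendental ℤ s :=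
    ⟨_, transcendental_liouvilleNumber (m := 2) le_rfl⟩
  refine ⟨fun j => s ^ (j : ℕ), fun k l hkl => ?_⟩
  have h := (transcendental_iff.1 hs)
    (∑ j : Fin d, Polynomial.monomial (j : ℕ) (k j - l j)) (by
      simp only [dotP] at hkl
      simp [Polynomial.aeval_monomial, Finset.sum_sub_distrib, hkl])
  funext i
  have hi := congrArg (fun q => Polynomial.coeff q (i : ℕ)) h
  simp only [Polynomial.finsetSum_coeff, Polynomial.coeff_monomial, Polynomial.coeff_zero,
    Fin.val_inj, Finset.sum_ite_eq', Finset.mem_univ, if_true] at hi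
  exact sub_eq_zero.1 hi

/-- The character `t ↦ exp (-i a t)` of the additive group `ℝ`. -/
def expChar (a : ℝ) : Multiplicative ℝ →* ℂ where
  toFun t := Complex.exp (-((t.toAdd * a : ℝ) : ℂ) * Complex.I)
  map_one' := by simp
  map_mul' s t := by
    rw [← Complex.exp_add]
    congr 1
    push_cast [toAdd_mul]
    ring

lemma expChar_injective : Function.Injective expChar := by
  intro a b hab
  have hd : ∀ c : ℝ, HasDerivAt (fun t : ℝ => Complex.exp (-((t * c : ℝ) : ℂ) * Complex.I))
      (-(c : ℂ) * Complex.I) 0 := by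
    intro c
    have h1 : HasDerivAt (fun t : ℝ => ((t * c : ℝ) : ℂ)) (c : ℂ) 0 := by
      simpa using ((hasDerivAt_id (0 : ℝ)).mul_const c).ofReal_comp
    simpa using (h1.neg.mul_const Complex.I).cexp
  have h2 : (fun t : ℝ => Complex.exp (-((t * a : ℝ) : ℂ) * Complex.I)) =
      fun t : ℝ => Complex.exp (-((t * b : ℝ) : ℂ) * Complex.I) :=
    funext fun t => DFunLike.congr_fun hab (Multiplicative.ofAdd t)
  have h3 := (hd a).unique (h2 ▸ hd b)
  simpa using h3

lemma exists_eval_line_ne_zero {d : ℕ} {Λ : Finset (Fin d → ℤ)} (hΛ : ∀ k ∈ Λ, -k ∈ Λ)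
    {p : (Fin d → ℤ) → ℂ} (hp : IsCoeff d Λ p) (hp0 : p ≠ 0) {v : Fin d → ℝ}
    (hv : Function.Injective fun k : Fin d → ℤ => dotP d k v) (y : Fin d → ℝ) :
    ∃ t : ℝ, eval d Λ p (y + t • v) ≠ 0 := by
  by_contra! h
  refine hp0 (funext fun k => ?_)
  by_cases hk : k ∈ Λ
  swap
  · exact hp.1 k hk
  have hli := (linearIndependent_monoidHom (Multiplicative ℝ) ℂ).comp
    (fun k : Fin d → ℤ => expChar (dotP d k v)) (expChar_injective.comp hv)
  have hz := (linearIndependent_iff'.1 hli) Λ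
    (fun k => p k * Complex.exp (-(dotP d k y : ℂ) * Complex.I)) (by
      funext t
      have ht := csum_eq_eval hΛ hp (y + t.toAdd • v)
      rw [h, csum] at ht
      simp only [Finset.sum_apply, Pi.smul_apply, Pi.zero_apply, smul_eq_mul, Function.comp]
      rw [Complex.ofReal_zero] at ht
      rw [← ht]
      refine Finset.sum_congr rfl fun k _ => ?_
      rw [dotP_add_smul, mul_assoc]
      congr 1
      simp only [expChar, MonoidHom.coe_mk, OneHom.coe_mk]
      rw [← Complex.exp_add]
      congr 1
      push_cast
      ring) k hk
  exact (mul_eq_zero.1 hz).resolve_right (Complex.exp_ne_zero _)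

lemma contDiff_eval (d : ℕ) (Λ : Finset (Fin d → ℤ)) (p : (Fin d → ℤ) → ℂ) :
    ContDiff ℝ ⊤ (eval d Λ p) := by
  have h : ContDiff ℝ ⊤ (csum d Λ p) := by
    refine ContDiff.sum fun k _ => contDiff_const.mul ?_
    refine ContDiff.cexp (ContDiff.mul (ContDiff.neg ?_) contDiff_const)
    refine Complex.ofRealCLM.contDiff.comp ?_
    change ContDiff ℝ ⊤ fun θ : Fin d → ℝ => ∑ j, (k j : ℝ) * θ j
    fun_prop
  exact Complex.reCLM.contDiff.comp h

lemma continuous_eval (d : ℕ) (Λ : Finset (Fin d → ℤ)) (p : (Fin d → ℤ) → ℂ) :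
    Continuous (eval d Λ p) := (contDiff_eval d Λ p).continuous

/-- The zero set of a nonzero trigonometric polynomial is Lebesgue null. -/
lemma ae_eval_ne_zero {d : ℕ} {Λ : Finset (Fin d → ℤ)} (hΛ : ∀ k ∈ Λ, -k ∈ Λ)
    {p : (Fin d → ℤ) → ℂ} (hp : IsCoeff d Λ p) (hp0 : p ≠ 0) :
    ∀ᵐ θ, eval d Λ p θ ≠ 0 := by
  obtain ⟨v, hv⟩ := exists_dotP_injective d
  refine ae_mem_of_ae_add_linearMap_mem (LinearMap.toSpanSingleton ℝ (Fin d → ℝ) v)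
    (volume : Measure ℝ) volume (s := {θ | eval d Λ p θ ≠ 0})
    ((continuous_eval d Λ p).measurable (measurableSet_singleton 0).compl) fun y => ?_
  have hc : ContDiff ℝ ⊤ fun t : ℝ => eval d Λ p (y + t • v) :=
    (contDiff_eval d Λ p).comp (by fun_prop)
  have ha : AnalyticOnNhd ℝ (fun t : ℝ => eval d Λ p (y + t • v)) univ :=
    fun t _ => hc.contDiffAt.analyticAt
  obtain ⟨t, ht⟩ := exists_eval_line_ne_zero hΛ hp hp0 hv y
  have h := ae_restrict_le_codiscreteWithin (μ := (volume : Measure ℝ)) MeasurableSet.univ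
    (ha.preimage_zero_mem_codiscreteWithin ht (mem_univ t) isConnected_univ)
  rw [Measure.restrict_univ] at h
  exact h

lemma measurableSet_Td (d : ℕ) : MeasurableSet (Td d) :=
  MeasurableSet.univ_pi fun _ => measurableSet_Ioc

lemma Td_subset_Icc (d : ℕ) :
    Td d ⊆ Icc (fun _ => -Real.pi) (fun _ => Real.pi) := fun _ hθ =>
  ⟨fun j => (hθ j (mem_univ j)).1.le, fun j => (hθ j (mem_univ j)).2⟩

lemma dm_scale_ne_top (d : ℕ) : (ENNReal.ofReal ((2 * Real.pi) ^ d))⁻¹ ≠ ⊤ :=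
  ENNReal.inv_ne_top.2 (ENNReal.ofReal_pos.2 (by positivity)).ne'

lemma ae_dm_of_ae {d : ℕ} {s : (Fin d → ℝ) → Prop} (h : ∀ᵐ θ, s θ) : ∀ᵐ θ ∂(dm d), s θ :=
  Measure.ae_smul_measure (ae_restrict_of_ae h) _

lemma ae_dm_mem_Td (d : ℕ) : ∀ᵐ θ ∂(dm d), θ ∈ Td d :=
  Measure.ae_smul_measure (ae_restrict_mem (measurableSet_Td d)) _

lemma integrable_dm_of_continuous {d : ℕ} {f : (Fin d → ℝ) → ℝ} (hf : Continuous f) :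
    Integrable f (dm d) :=
  ((hf.continuousOn.integrableOn_compact isCompact_Icc).mono_set
    (Td_subset_Icc d)).smul_measure (dm_scale_ne_top d)

lemma ae_eval_pos {d : ℕ} {Λ : Finset (Fin d → ℤ)} (hΛ : ∀ k ∈ Λ, -k ∈ Λ)
    {q : (Fin d → ℤ) → ℂ} (hq : q ∈ Pbar d Λ) (hq0 : q ≠ 0) :
    ∀ᵐ θ ∂(dm d), 0 < eval d Λ q θ := by
  filter_upwards [ae_dm_of_ae (ae_eval_ne_zero hΛ hq.1 hq0), ae_dm_mem_Td d] with θ h1 h2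
  exact (hq.2 θ h2).lt_of_ne' h1

/-- Trigonometric polynomials take the same values at `-π` and `π`. -/
lemma eval_fold (d : ℕ) (Λ : Finset (Fin d → ℤ)) (p : (Fin d → ℤ) → ℂ) (θ : Fin d → ℝ) :
    eval d Λ p (fun j => if θ j = -Real.pi then Real.pi else θ j) = eval d Λ p θ := by
  unfold eval
  congr 1
  refine Finset.sum_congr rfl fun k _ => ?_
  congr 1
  refine Complex.exp_eq_exp_iff_exists_int.2
    ⟨-∑ j, if θ j = -Real.pi then k j else 0, ?_⟩
  have h : dotP d k (fun j => if θ j = -Real.pi then Real.pi else θ j) =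
      dotP d k θ + (∑ j, if θ j = -Real.pi then (k j : ℝ) else 0) * (2 * Real.pi) := by
    simp only [dotP, Finset.sum_mul, ← Finset.sum_add_distrib]
    refine Finset.sum_congr rfl fun j _ => ?_
    split_ifs with hj
    · rw [hj]; ring
    · ring
  rw [h]
  push_cast [apply_ite]
  ring

lemma exists_pos_le_eval {d : ℕ} {Λ : Finset (Fin d → ℤ)} {p : (Fin d → ℤ) → ℂ}
    (hp : p ∈ Pplus d Λ) : ∃ m > 0, ∀ θ ∈ Td d, m ≤ eval d Λ p θ := by
  have hne : (Icc (fun _ => -Real.pi) (fun _ => Real.pi) : Set (Fin d → ℝ)).Nonempty :=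
    nonempty_Icc.2 fun _ => by linarith [Real.pi_pos]
  obtain ⟨x, hx, hmin⟩ := isCompact_Icc.exists_isMinOn hne (continuous_eval d Λ p).continuousOn
  refine ⟨eval d Λ p x, ?_, fun θ hθ => hmin (Td_subset_Icc d hθ)⟩
  rw [← eval_fold]
  refine hp.2 _ fun j _ => ?_
  dsimp only
  split_ifs with h
  · exact ⟨by linarith [Real.pi_pos], le_rfl⟩
  · exact ⟨(hx.1 j).lt_of_ne' h, hx.2 j⟩

/-- The trigonometric polynomial `q + ε`. -/
def shift (d : ℕ) (q : (Fin d → ℤ) → ℂ) (ε : ℝ) : (Fin d → ℤ) → ℂ :=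
  q + Pi.single 0 (ε : ℂ)

section shift

variable {d : ℕ} {Λ : Finset (Fin d → ℤ)} {q : (Fin d → ℤ) → ℂ} {ε : ℝ}

lemma eval_shift (h0 : (0 : Fin d → ℤ) ∈ Λ) (θ : Fin d → ℝ) :
    eval d Λ (shift d q ε) θ = eval d Λ q θ + ε := by
  simp [eval, shift, add_mul, Finset.sum_add_distrib, Pi.single_apply, h0, dotP]

lemma pair_shift (h0 : (0 : Fin d → ℤ) ∈ Λ) (c : (Fin d → ℤ) → ℂ) :
    pair d Λ c (shift d q ε) = pair d Λ c q + ε * (c 0).re := by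
  have h : ∑ k ∈ Λ, c k * starRingEnd ℂ ((Pi.single 0 (ε : ℂ) : (Fin d → ℤ) → ℂ) k) =
      c 0 * ε := by
    rw [Finset.sum_eq_single_of_mem 0 h0 fun k _ hk => by simp [hk]]
    simp
  simp only [pair, shift, Pi.add_apply, map_add, mul_add, Finset.sum_add_distrib, h,
    Complex.add_re, Complex.re_mul_ofReal, mul_comm ε]

lemma shift_mem_Pbar (h0 : (0 : Fin d → ℤ) ∈ Λ) (hq : q ∈ Pbar d Λ) (hε : 0 ≤ ε) :
    shift d q ε ∈ Pbar d Λ := by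
  refine ⟨⟨fun k hk => ?_, fun k => ?_⟩, fun θ hθ => ?_⟩
  · have : k ≠ 0 := fun h => hk (h ▸ h0)
    simp [shift, hq.1.1 k hk, this]
  · by_cases hk : k = 0 <;> simp [shift, ← hq.1.2, hk]
  · rw [eval_shift h0]
    exact add_nonneg (hq.2 θ hθ) hε

lemma shift_ne_zero (h0 : (0 : Fin d → ℤ) ∈ Λ) (hq : q ∈ Pbar d Λ) (hε : 0 < ε) :
    shift d q ε ≠ 0 := by
  intro h
  have hπ : (fun _ => Real.pi : Fin d → ℝ) ∈ Td d :=
    fun _ _ => ⟨by linarith [Real.pi_pos], le_rfl⟩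
  have h1 := eval_shift (q := q) (ε := ε) h0 fun _ => Real.pi
  have h2 := hq.2 _ hπ
  rw [h] at h1
  simp only [eval, Pi.zero_apply, zero_mul, Finset.sum_const_zero, Complex.zero_re] at h1 h2
  linarith

end shift

lemma eval_smul (d : ℕ) (Λ : Finset (Fin d → ℤ)) (q : (Fin d → ℤ) → ℂ) (a : ℝ)
    (θ : Fin d → ℝ) : eval d Λ (a • q) θ = a * eval d Λ q θ := by
  simp only [eval, Pi.smul_apply, smul_mul_assoc, ← Finset.smul_sum, Complex.smul_re,
    smul_eq_mul]

lemma pair_smul (d : ℕ) (Λ : Finset (Fin d → ℤ)) (c q : (Fin d → ℤ) → ℂ) (a : ℝ) :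
    pair d Λ c (a • q) = a * pair d Λ c q := by
  rw [pair, pair, ← smul_eq_mul (a := a), ← Complex.smul_re, Finset.smul_sum]
  congr 1
  refine Finset.sum_congr rfl fun k _ => ?_
  simp [mul_left_comm]

lemma smul_mem_Pbar {d : ℕ} {Λ : Finset (Fin d → ℤ)} {q : (Fin d → ℤ) → ℂ}
    (hq : q ∈ Pbar d Λ) {a : ℝ} (ha : 0 ≤ a) : a • q ∈ Pbar d Λ := by
  refine ⟨⟨fun k hk => by simp [hq.1.1 k hk], fun k => by simp [hq.1.2 k]⟩, fun θ hθ => ?_⟩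
  rw [eval_smul]
  exact mul_nonneg ha (hq.2 θ hθ)

/-- The logarithmic integrand is integrable at a minimizer: otherwise the integral in `J` takes
its default value `0`, also at half the minimizer, which then has a smaller value of `J`. -/
lemma integrable_mul_log_of_isMin {d : ℕ} {Λ : Finset (Fin d → ℤ)} (hΛ : ∀ k ∈ Λ, -k ∈ Λ)
    {c P q : (Fin d → ℤ) → ℂ} (hc : c ∈ Cplus d Λ) (hq : q ∈ Pbar d Λ) (hq0 : q ≠ 0)
    (hmin : ∀ Q ∈ Pbar d Λ \ {0}, J d Λ c P q ≤ J d Λ c P Q) :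
    Integrable (fun θ => eval d Λ P θ * Real.log (eval d Λ q θ)) (dm d) := by
  by_contra hni
  have hni2 : ¬ Integrable
      (fun θ => eval d Λ P θ * Real.log (eval d Λ ((1 / 2 : ℝ) • q) θ)) (dm d) := by
    intro h
    refine hni ((h.sub ((integrable_dm_of_continuous (continuous_eval d Λ P)).mul_const
      (Real.log (1 / 2)))).congr ?_)
    filter_upwards [ae_eval_pos hΛ hq hq0] with θ hθ
    simp only [Pi.sub_apply]
    rw [eval_smul, Real.log_mul (by norm_num) hθ.ne']
    ring
  have h := hmin ((1 / 2 : ℝ) • q) ⟨smul_mem_Pbar hq (by norm_num), by simpa using hq0⟩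
  rw [J, J, integral_undef hni, integral_undef hni2, pair_smul] at h
  linarith [hc.2 q hq hq0]

lemma div_add_le_log_sub_log {x ε : ℝ} (hx : 0 < x) (hε : 0 < ε) :
    ε * (x + ε)⁻¹ ≤ Real.log (x + ε) - Real.log x := by
  have h := Real.log_le_sub_one_of_pos (div_pos hx (add_pos hx hε))
  rw [Real.log_div hx.ne' (add_pos hx hε).ne'] at h
  have h2 : x / (x + ε) - 1 = -(ε * (x + ε)⁻¹) := by
    have := (add_pos hx hε).ne'
    field_simp
    ring
  linarith

lemma lintegral_inv_shift_le {d : ℕ} {Λ : Finset (Fin d → ℤ)} (h0 : (0 : Fin d → ℤ) ∈ Λ)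
    (hΛ : ∀ k ∈ Λ, -k ∈ Λ)
    {c P q : (Fin d → ℤ) → ℂ} (hc : c ∈ Cplus d Λ) (hq : q ∈ Pbar d Λ) (hq0 : q ≠ 0)
    (hmin : ∀ Q ∈ Pbar d Λ \ {0}, J d Λ c P q ≤ J d Λ c P Q)
    {m : ℝ} (hm : 0 < m) (hmP : ∀ θ ∈ Td d, m ≤ eval d Λ P θ) {ε : ℝ} (hε : 0 < ε) :
    ∫⁻ θ, ENNReal.ofReal (eval d Λ q θ + ε)⁻¹ ∂(dm d) ≤ ENNReal.ofReal ((c 0).re / m) := by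
  have hi := integrable_mul_log_of_isMin hΛ hc hq hq0 hmin
  have hpos := ae_eval_pos hΛ hq hq0
  have hiε : Integrable (fun θ => eval d Λ P θ * Real.log (eval d Λ q θ + ε)) (dm d) := by
    have hcont : Continuous fun θ => eval d Λ P θ * Real.log (|eval d Λ q θ| + ε) :=
      (continuous_eval d Λ P).mul (((continuous_eval d Λ q).abs.add continuous_const).log
        fun θ => (add_pos_of_nonneg_of_pos (abs_nonneg _) hε).ne')
    refine (integrable_dm_of_continuous hcont).congr ?_
    filter_upwards [hpos] with θ hθ
    rw [abs_of_pos hθ]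
  have hJ := hmin (shift d q ε) ⟨shift_mem_Pbar h0 hq hε.le, shift_ne_zero h0 hq hε⟩
  simp only [J, pair_shift h0, eval_shift h0] at hJ
  have hbound : ∀ᵐ θ ∂(dm d), (eval d Λ q θ + ε)⁻¹ ≤ (m * ε)⁻¹ *
      (eval d Λ P θ * Real.log (eval d Λ q θ + ε) -
        eval d Λ P θ * Real.log (eval d Λ q θ)) := by
    filter_upwards [hpos, ae_dm_mem_Td d] with θ hθ hθT
    have h1 := div_add_le_log_sub_log hθ hε
    have h2 := hmP θ hθT
    have h3 : 0 ≤ ε * (eval d Λ q θ + ε)⁻¹ := by positivity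
    rw [inv_mul_eq_div, le_div_iff₀ (by positivity)]
    calc (eval d Λ q θ + ε)⁻¹ * (m * ε) = m * (ε * (eval d Λ q θ + ε)⁻¹) := by ring
      _ ≤ eval d Λ P θ * (Real.log (eval d Λ q θ + ε) - Real.log (eval d Λ q θ)) :=
          mul_le_mul h2 h1 h3 (hm.le.trans h2)
      _ = _ := by ring
  refine (lintegral_mono_ae (hbound.mono fun θ h => ENNReal.ofReal_le_ofReal h)).trans ?_
  have hint : Integrable (fun θ => (m * ε)⁻¹ * (eval d Λ P θ * Real.log (eval d Λ q θ + ε) -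
      eval d Λ P θ * Real.log (eval d Λ q θ))) (dm d) := (hiε.sub hi).const_mul _
  rw [← ofReal_integral_eq_lintegral_ofReal hint]
  · refine ENNReal.ofReal_le_ofReal ?_
    rw [integral_const_mul, integral_sub hiε hi, inv_mul_eq_div, div_le_div_iff₀ (by positivity) hm]
    nlinarith
  · filter_upwards [hbound, hpos] with θ h hθ
    exact le_trans (by positivity) h

/-- let P ∈ 𝔓₊ and c ∈ ℭ₊ and suppose ∫ 1/Q dm = ∞ for every
Q ∈ ∂𝔓₊ (= 𝔓̄₊ \ 𝔓₊, nontrivial).  Then any minimizer of J_P over 𝔓̄₊ \ {0}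
lies in the open cone 𝔓₊. -/
theorem statement11 (d : ℕ) (hd : 1 ≤ d) (Λ : Finset (Fin d → ℤ))
    (h0 : (0 : Fin d → ℤ) ∈ Λ) (hΛ : ∀ k ∈ Λ, -k ∈ Λ)
    (c P : (Fin d → ℤ) → ℂ) (hc : c ∈ Cplus d Λ) (hP : P ∈ Pplus d Λ)
    (hass : ∀ Q ∈ Pbar d Λ \ Pplus d Λ, Q ≠ 0 →
      ∫⁻ θ, ENNReal.ofReal (eval d Λ Q θ)⁻¹ ∂(dm d) = ⊤)
    (Qhat : (Fin d → ℤ) → ℂ) (hQhat : Qhat ∈ Pbar d Λ \ {0})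
    (hmin : ∀ Q ∈ Pbar d Λ \ {0}, J d Λ c P Qhat ≤ J d Λ c P Q) :
    Qhat ∈ Pplus d Λ := by
  by_contra hn
  obtain ⟨hq, hq0⟩ := hQhat
  obtain ⟨m, hm, hmP⟩ := exists_pos_le_eval hP
  have hmeas := (continuous_eval d Λ Qhat).measurable
  have hlim : ∀ᵐ θ ∂(dm d), ENNReal.ofReal (eval d Λ Qhat θ)⁻¹ = Filter.liminf
      (fun n : ℕ => ENNReal.ofReal (eval d Λ Qhat θ + 1 / ((n : ℝ) + 1))⁻¹) Filter.atTop := by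
    filter_upwards [ae_eval_pos hΛ hq hq0] with θ hθ
    refine (Filter.Tendsto.liminf_eq (ENNReal.tendsto_ofReal (Filter.Tendsto.inv₀ ?_ hθ.ne'))).symm
    simpa using tendsto_one_div_add_atTop_nhds_zero_nat.const_add (eval d Λ Qhat θ)
  have hle : ∫⁻ θ, ENNReal.ofReal (eval d Λ Qhat θ)⁻¹ ∂(dm d) ≤
      ENNReal.ofReal ((c 0).re / m) := by
    rw [lintegral_congr_ae hlim]
    refine (lintegral_liminf_le fun n => by fun_prop).trans ?_
    refine Filter.liminf_le_of_le (by isBoundedDefault) fun b hb => ?_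
    obtain ⟨n, hn⟩ := hb.exists
    exact hn.trans (lintegral_inv_shift_le h0 hΛ hc hq hq0 hmin hm hmP (by positivity))
  rw [hass Qhat ⟨hq, hn⟩ hq0] at hle
  exact ENNReal.ofReal_ne_top (top_le_iff.1 hle)

end RCE
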